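/- Let F be a properly parametrized Markov multi-map with forward trajectory space X (with left-shift map T) and associated SFT Σ_M. If Σ_M satisfies the Coding Condition (CC) and the Mixing Condition (MC), then (X,T) is topologically mixing and its periodic points are dense in X. -/

import Mathlib

open Set Topology

/-! ### Generic dynamical notions -/

/-- Topological transitivity of a map. -/
def TopTransitive {α : Type*} [TopologicalSpace α] (T : α → α) : Prop :=
  ∀ U V : Set α, IsOpen U → IsOpen V → U.Nonempty → V.Nonempty →
    ∃ n : ℕ, (T^[n] '' U ∩ V).Nonempty

/-- Topological mixing of a map. -/
def TopMixing {α : Type*} [TopologicalSpace α] (T : α → α) : Prop :=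
  ∀ U V : Set α, IsOpen U → IsOpen V → U.Nonempty → V.Nonempty →
    ∃ N : ℕ, ∀ n, N ≤ n → (T^[n] '' U ∩ V).Nonempty

/-- Density of the set of periodic points of a map. -/
def DensePeriodic {α : Type*} [TopologicalSpace α] (T : α → α) : Prop :=
  Dense {x : α | ∃ p : ℕ, 1 ≤ p ∧ T^[p] x = x}

/-- The metric `d(x,y) = sup_k |x_k - y_k|/(k+1)` on sequence spaces. -/
noncomputable def dseq (x y : ℕ → ℝ) : ℝ := ⨆ k : ℕ, |x k - y k| / ((k : ℝ) + 1)

/-- The specification property for a map `T` with respect to a distance function `d`. -/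
def SpecProp {α : Type*} (T : α → α) (d : α → α → ℝ) : Prop :=
  ∀ ε : ℝ, 0 < ε → ∃ N : ℕ, ∀ l : ℕ, ∀ x : Fin (l + 1) → α, ∀ a b : Fin (l + 1) → ℕ,
    (∀ k, 1 ≤ a k) → (∀ k, a k ≤ b k) →
    (∀ k : Fin l, b k.castSucc < a k.succ ∧ b k.castSucc + N ≤ a k.succ) →
    ∀ p : ℕ, b (Fin.last l) + N ≤ p →
      ∃ z : α, T^[p] z = z ∧
        ∀ k : Fin (l + 1), ∀ i : ℕ, a k ≤ i → i ≤ b k → d (T^[i] z) (T^[i] (x k)) < ε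

/-- The length `ℓ` of a (possibly degenerate) interval. -/
noncomputable def intervalLen (I : Set ℝ) : ℝ := sSup I - sInf I

/-! ### Markov multi-maps -/

/-- A Markov multi-map of the interval, given by a tuple
`(P, A₀, A₁, A₂, D, R, {f_a})` as in the paper, together with the derived data
(inverse maps `g`, interiors `D0`, `R0`, graphs `Gr`, `G0`) which are uniquely
determined by the defining equations below. -/
structure MarkovMultiMap where
  A : Type
  finA : Finite A
  A0 : Set A
  A1 : Set A
  A2 : Set A
  P : Finset ℝ
  D : A → Set ℝ
  R : A → Set ℝ
  f : A → ℝ → ℝ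
  g : A → ℝ → ℝ
  D0 : A → Set ℝ
  R0 : A → Set ℝ
  Gr : A → Set (ℝ × ℝ)
  G0 : A → Set (ℝ × ℝ)
  P_zero : (0 : ℝ) ∈ P
  P_one : (1 : ℝ) ∈ P
  P_sub : (P : Set ℝ) ⊆ Set.Icc 0 1
  A_cover : ∀ a : A, a ∈ A0 ∨ a ∈ A1 ∨ a ∈ A2
  A01 : A0 ∩ A1 = ∅
  A02 : A0 ∩ A2 = ∅
  A12 : A1 ∩ A2 = ∅
  D_A0 : ∀ a ∈ A0, ∃ p ∈ P, ∃ q ∈ P, p < q ∧ (∀ r ∈ P, ¬(p < r ∧ r < q)) ∧ D a = Set.Icc p q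
  D_A12 : ∀ a ∈ A1 ∪ A2, ∃ p ∈ P, D a = {p}
  R_A0 : ∀ a ∈ A0, ∃ u ∈ P, ∃ v ∈ P, u < v ∧ R a = Set.Icc u v
  R_A1 : ∀ a ∈ A1, ∃ u ∈ P, ∃ v ∈ P, u < v ∧ R a = Set.Icc u v ∧
    Set.Icc u v ∩ (P : Set ℝ) = {u, v}
  R_A2 : ∀ a ∈ A2, ∃ u ∈ P, R a = {u}
  f_homeo : ∀ a ∈ A0, ContinuousOn (f a) (D a) ∧ Set.BijOn (f a) (D a) (R a)
  g_A0 : ∀ a ∈ A0, (∀ x ∈ D a, g a (f a x) = x) ∧ ∀ y ∈ R a, g a y ∈ D a ∧ f a (g a y) = y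
  g_A12 : ∀ a ∈ A1 ∪ A2, ∀ y ∈ R a, g a y ∈ D a
  cover : Set.Icc (0 : ℝ) 1 = ⋃ a : A, D a
  D0_A0 : ∀ a ∈ A0, D0 a = interior (D a)
  D0_A12 : ∀ a ∈ A1 ∪ A2, D0 a = D a
  R0_A01 : ∀ a ∈ A0 ∪ A1, R0 a = interior (R a)
  R0_A2 : ∀ a ∈ A2, R0 a = R a
  Gr_A0 : ∀ a ∈ A0, Gr a = {q : ℝ × ℝ | q.1 ∈ D a ∧ q.2 = f a q.1}
  Gr_A12 : ∀ a ∈ A1 ∪ A2, Gr a = (D a) ×ˢ (R a)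
  G0_A0 : ∀ a ∈ A0, G0 a = {q : ℝ × ℝ | q.1 ∈ D0 a ∧ q.2 = f a q.1}
  G0_A1 : ∀ a ∈ A1, G0 a = (D a) ×ˢ (R0 a)
  G0_A2 : ∀ a ∈ A2, G0 a = Gr a

namespace MarkovMultiMap

variable (M : MarkovMultiMap)

/-- The graph `G(F)` of the multi-map. -/
def GF : Set (ℝ × ℝ) := ⋃ a : M.A, M.Gr a

/-- `F` is properly parametrized: the sets `G₀(a)` partition `G(F)`. -/
def ProperlyParametrized : Prop :=
  (⋃ a : M.A, M.G0 a) = M.GF ∧ ∀ a b : M.A, a ≠ b → Disjoint (M.G0 a) (M.G0 b)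

/-- The forward trajectory space `X`. -/
def X : Set (ℕ → ℝ) :=
  {x | (∀ k, x k ∈ Set.Icc (0 : ℝ) 1) ∧ ∀ k, (x k, x (k + 1)) ∈ M.GF}

/-- The left-shift map `T` on the forward trajectory space. -/
def shift : M.X → M.X :=
  fun x => ⟨fun k => x.1 (k + 1), ⟨fun k => x.2.1 (k + 1), fun k => x.2.2 (k + 1)⟩⟩

/-- The inverse trajectory (inverse limit) space `Y`, encoded by `y k = y_{-k}`. -/
def Y : Set (ℕ → ℝ) :=
  {y | (∀ k, y k ∈ Set.Icc (0 : ℝ) 1) ∧ ∀ k, (y (k + 1), y k) ∈ M.GF}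

/-- The right-shift map `S` on the inverse limit space (in the encoding `y k = y_{-k}`). -/
def ishift : M.Y → M.Y :=
  fun y => ⟨fun k => y.1 (k + 1), ⟨fun k => y.2.1 (k + 1), fun k => y.2.2 (k + 1)⟩⟩

/-- The space `X_n` of finite trajectories of length `n`. -/
def finTraj (n : ℕ) : Set (Fin n → ℝ) :=
  {x | (∀ i, x i ∈ Set.Icc (0 : ℝ) 1) ∧
    ∀ i : Fin n, ∀ h : (i : ℕ) + 1 < n, (x i, x ⟨(i : ℕ) + 1, h⟩) ∈ M.GF}

/-- The associated nearest-neighbor SFT `Σ_M`. -/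
def SFT : Set (ℕ → M.A) := {a | ∀ n : ℕ, M.D0 (a (n + 1)) ⊆ M.R0 (a n)}

/-- The word `u` (of length `n`) occurs in some point of `Z`. -/
def WordIn {n : ℕ} (u : Fin n → M.A) (Z : Set (ℕ → M.A)) : Prop :=
  ∃ z ∈ Z, ∃ m : ℕ, ∀ i : Fin n, u i = z (m + (i : ℕ))

/-- `L_n`, the words of length `n` in the language of `Σ_M`. -/
def Lang (n : ℕ) : Set (Fin n → M.A) := {u | M.WordIn u M.SFT}

/-- `(x,u)` is a labeled finite trajectory: `(x_k, x_{k+1}) ∈ G(u_k)` for all `k`. -/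
def Labeled {n : ℕ} (x : Fin (n + 1) → ℝ) (u : Fin n → M.A) : Prop :=
  ∀ i : Fin n, (x i.castSucc, x i.succ) ∈ M.Gr (u i)

/-- `(x,u)` is a special labeled finite trajectory: `(x_k, x_{k+1}) ∈ G₀(u_k)` for all `k`. -/
def SpecialLabeled {n : ℕ} (x : Fin (n + 1) → ℝ) (u : Fin n → M.A) : Prop :=
  ∀ i : Fin n, (x i.castSucc, x i.succ) ∈ M.G0 (u i)

/-- A word `u ∈ L_n` is essential if the set of finite trajectories specially labeled
by `u` is open in `X_{n+1}`. -/
def EssentialWord {n : ℕ} (u : Fin n → M.A) : Prop :=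
  u ∈ M.Lang n ∧ IsOpen {x : M.finTraj (n + 1) | M.SpecialLabeled x.1 u}

/-- A symbol is essential if it appears in some essential word. -/
def EssentialSymbol (a : M.A) : Prop :=
  ∃ n : ℕ, ∃ u : Fin n → M.A, M.EssentialWord u ∧ ∃ i : Fin n, u i = a

/-- `A^(e)`, the set of essential symbols. -/
def Ess : Set M.A := {a | M.EssentialSymbol a}

/-- `E`, the set of essential symbolic sequences. -/
def E : Set (ℕ → M.A) := {z ∈ M.SFT | ∀ i : ℕ, z i ∈ M.Ess}

/-- A word all of whose letters lie in `C`, in the language of `Σ_M`. -/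
def WordOver {n : ℕ} (u : Fin n → M.A) (C : Set M.A) : Prop :=
  u ∈ M.Lang n ∧ ∀ i, u i ∈ C

/-- There is a word of length `n+1` over `C` beginning with `a` and ending with `b`. -/
def WordFromTo (C : Set M.A) (a b : M.A) (n : ℕ) : Prop :=
  ∃ u : Fin (n + 1) → M.A, M.WordOver u C ∧ u 0 = a ∧ u (Fin.last n) = b

/-- `C ⊆ A` is irreducible. -/
def IrreducibleSet (C : Set M.A) : Prop :=
  ∀ a ∈ C, ∀ b ∈ C, ∃ n : ℕ, M.WordFromTo C a b n

/-- `C` is an irreducible component (a maximal irreducible subset of `A`). -/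
def IrreducibleComponent (C : Set M.A) : Prop :=
  M.IrreducibleSet C ∧ ∀ C' : Set M.A, M.IrreducibleSet C' → C ⊆ C' → C' = C

/-- `C ⊆ A` is mixing. -/
def MixingSet (C : Set M.A) : Prop :=
  ∃ N : ℕ, 1 ≤ N ∧ ∀ a ∈ C, ∀ b ∈ C, ∀ n : ℕ, N ≤ n + 1 → M.WordFromTo C a b n

/-- `C` is a mixing component (a maximal mixing subset of `A`). -/
def MixingComponent (C : Set M.A) : Prop :=
  M.MixingSet C ∧ ∀ C' : Set M.A, M.MixingSet C' → C ⊆ C' → C' = C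

/-- The Irreducibility Condition (IC). -/
def IC : Prop := ∃ C : Set M.A, M.IrreducibleComponent C ∧ M.Ess ⊆ C

/-- The Mixing Condition (MC). -/
def MC : Prop := ∃ C : Set M.A, M.MixingComponent C ∧ M.Ess ⊆ C

/-- `Z` is a subshift of `Σ_M`: shift-invariant and closed in the product of discrete
topologies (closedness phrased combinatorially). -/
def IsSubshift (Z : Set (ℕ → M.A)) : Prop :=
  Z ⊆ M.SFT ∧ (∀ z ∈ Z, (fun k => z (k + 1)) ∈ Z) ∧
  ∀ x : ℕ → M.A, (∀ n : ℕ, ∃ z ∈ Z, ∀ i, i < n → z i = x i) → x ∈ Z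

/-- The symbol `a` occurs in some point of `Z`. -/
def SymbolInShift (Z : Set (ℕ → M.A)) (a : M.A) : Prop := ∃ z ∈ Z, ∃ k : ℕ, z k = a

/-- `Z` is transitive on symbols. -/
def TransitiveOnSymbols (Z : Set (ℕ → M.A)) : Prop :=
  ∀ a b : M.A, M.SymbolInShift Z a → M.SymbolInShift Z b →
    ∃ z ∈ Z, ∃ m n : ℕ, z m = a ∧ z (m + n) = b

end MarkovMultiMap

/-- The composition `g_{u₀} ∘ ⋯ ∘ g_{u_n}` of inverse maps along a list of symbols. -/
def gWordList (M : MarkovMultiMap) : List M.A → ℝ → ℝ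
  | [], x => x
  | a :: l, x => M.g a (gWordList M l x)

namespace MarkovMultiMap

/-- The inverse map `g_u` associated to a word `u = u₀⋯u_n`. -/
def gWord (M : MarkovMultiMap) {n : ℕ} (u : Fin (n + 1) → M.A) : ℝ → ℝ :=
  gWordList M (List.ofFn u)

/-- The interval `I_u = g_u(R(u_n))`. -/
def Iword (M : MarkovMultiMap) {n : ℕ} (u : Fin (n + 1) → M.A) : Set ℝ :=
  M.gWord u '' M.R (u (Fin.last n))

/-- The Coding Condition (CC). -/
def CC (M : MarkovMultiMap) : Prop :=
  ∃ Z : Set (ℕ → M.A), M.IsSubshift Z ∧ M.TransitiveOnSymbols Z ∧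
    (∀ y ∈ Set.Icc (0 : ℝ) 1, ∃ a ∈ Z, ∃ x ∈ M.X, x 0 = y ∧
      ∀ i : ℕ, (x i, x (i + 1)) ∈ M.Gr (a i)) ∧
    (∀ ε : ℝ, 0 < ε → ∃ N : ℕ, ∀ n : ℕ, N ≤ n → ∀ u : Fin (n + 1) → M.A,
      M.WordIn u Z → intervalLen (M.Iword u) < ε)

/-- Uniform equicontinuity of the family `{g_u : u ∈ L(C)}`. -/
def UnifEquicontOn (M : MarkovMultiMap) (C : Set M.A) : Prop :=
  ∀ ε : ℝ, 0 < ε → ∃ δ : ℝ, 0 < δ ∧ ∀ n : ℕ, ∀ u : Fin (n + 1) → M.A, M.WordOver u C →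
    ∀ x ∈ M.R (u (Fin.last n)), ∀ y ∈ M.R (u (Fin.last n)),
      |x - y| < δ → |M.gWord u x - M.gWord u y| < ε

end MarkovMultiMap

namespace MarkovMultiMap

variable {M : MarkovMultiMap}

/-! ### Elementary facts about domains, ranges and graphs -/

lemma D_eq_Icc (a : M.A) : ∃ p ∈ M.P, ∃ q ∈ M.P, p ≤ q ∧ (∀ r ∈ M.P, ¬(p < r ∧ r < q)) ∧
    M.D a = Set.Icc p q := by
  by_cases h0 : a ∈ M.A0
  · obtain ⟨p, hp, q, hq, hpq, hr, hD⟩ := M.D_A0 a h0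
    exact ⟨p, hp, q, hq, hpq.le, hr, hD⟩
  · have h : a ∈ M.A1 ∪ M.A2 := by
      rcases M.A_cover a with h | h | h
      exacts [absurd h h0, Or.inl h, Or.inr h]
    obtain ⟨p, hp, hD⟩ := M.D_A12 a h
    exact ⟨p, hp, p, hp, le_rfl, fun r _ hr => lt_asymm hr.1 hr.2, by simp [hD]⟩

lemma R_eq_Icc (a : M.A) : ∃ u ∈ M.P, ∃ v ∈ M.P, u ≤ v ∧ M.R a = Set.Icc u v := by
  rcases M.A_cover a with h | h | h
  · obtain ⟨u, hu, v, hv, huv, hR⟩ := M.R_A0 a h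
    exact ⟨u, hu, v, hv, huv.le, hR⟩
  · obtain ⟨u, hu, v, hv, huv, hR, -⟩ := M.R_A1 a h
    exact ⟨u, hu, v, hv, huv.le, hR⟩
  · obtain ⟨u, hu, hR⟩ := M.R_A2 a h
    exact ⟨u, hu, u, hu, le_rfl, by simp [hR]⟩

lemma R_eq_Icc_of_notMem_A2 {a : M.A} (ha : a ∉ M.A2) :
    ∃ u ∈ M.P, ∃ v ∈ M.P, u < v ∧ M.R a = Set.Icc u v := by
  rcases M.A_cover a with h | h | h
  · exact M.R_A0 a h
  · obtain ⟨u, hu, v, hv, huv, hR, -⟩ := M.R_A1 a h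
    exact ⟨u, hu, v, hv, huv, hR⟩
  · exact absurd h ha

lemma isClosed_R (a : M.A) : IsClosed (M.R a) := by
  obtain ⟨u, -, v, -, -, h⟩ := M.R_eq_Icc a
  exact h ▸ isClosed_Icc

lemma isClosed_D (a : M.A) : IsClosed (M.D a) := by
  obtain ⟨u, -, v, -, -, -, h⟩ := M.D_eq_Icc a
  exact h ▸ isClosed_Icc

lemma R_subset (a : M.A) : M.R a ⊆ Set.Icc 0 1 := by
  obtain ⟨u, hu, v, hv, -, h⟩ := M.R_eq_Icc a
  rw [h]
  exact Set.Icc_subset_Icc (M.P_sub hu).1 (M.P_sub hv).2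

lemma D_subset (a : M.A) : M.D a ⊆ Set.Icc 0 1 := by
  rw [M.cover]
  exact Set.subset_iUnion _ a

lemma D_nonempty (a : M.A) : (M.D a).Nonempty := by
  obtain ⟨u, -, v, -, huv, -, h⟩ := M.D_eq_Icc a
  exact h ▸ Set.nonempty_Icc.2 huv

lemma mem_A12_of_notMem_A0 {a : M.A} (ha : a ∉ M.A0) : a ∈ M.A1 ∪ M.A2 := by
  rcases M.A_cover a with h | h | h
  exacts [absurd h ha, Or.inl h, Or.inr h]

lemma notMem_A2_of_mem_A0 {a : M.A} (ha : a ∈ M.A0) : a ∉ M.A2 := fun h => by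
  have : a ∈ M.A0 ∩ M.A2 := ⟨ha, h⟩
  simp [M.A02] at this

lemma notMem_A2_of_mem_A1 {a : M.A} (ha : a ∈ M.A1) : a ∉ M.A2 := fun h => by
  have : a ∈ M.A1 ∩ M.A2 := ⟨ha, h⟩
  simp [M.A12] at this

lemma mapsTo_g (a : M.A) : MapsTo (M.g a) (M.R a) (M.D a) := by
  intro y hy
  by_cases h0 : a ∈ M.A0
  · exact ((M.g_A0 a h0).2 y hy).1
  · exact M.g_A12 a (mem_A12_of_notMem_A0 h0) y hy

lemma mem_Gr_iff {a : M.A} {x y : ℝ} : (x, y) ∈ M.Gr a ↔ y ∈ M.R a ∧ x = M.g a y := by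
  by_cases h0 : a ∈ M.A0
  · rw [M.Gr_A0 a h0]
    constructor
    · rintro ⟨hx, hy⟩
      simp only at hx hy
      subst hy
      exact ⟨(M.f_homeo a h0).2.mapsTo hx, ((M.g_A0 a h0).1 x hx).symm⟩
    · rintro ⟨hy, rfl⟩
      exact ⟨((M.g_A0 a h0).2 y hy).1, ((M.g_A0 a h0).2 y hy).2.symm⟩
  · have h := mem_A12_of_notMem_A0 h0
    obtain ⟨p, -, hp⟩ := M.D_A12 a h
    have hg := M.g_A12 a h y
    rw [M.Gr_A12 a h, Set.mem_prod, hp]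
    rw [hp] at hg
    constructor
    · rintro ⟨hx, hy⟩
      exact ⟨hy, hx.trans (hg hy).symm⟩
    · rintro ⟨hy, rfl⟩
      exact ⟨hg hy, hy⟩

lemma mem_D_of_mem_Gr {a : M.A} {x y : ℝ} (h : (x, y) ∈ M.Gr a) : x ∈ M.D a := by
  obtain ⟨hy, rfl⟩ := mem_Gr_iff.1 h
  exact M.mapsTo_g a hy

lemma mem_GF_of_mem_Gr {a : M.A} {z : ℝ × ℝ} (h : z ∈ M.Gr a) : z ∈ M.GF :=
  Set.mem_iUnion.2 ⟨a, h⟩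

lemma continuousOn_g (a : M.A) : ContinuousOn (M.g a) (M.R a) := by
  by_cases h0 : a ∈ M.A0
  · obtain ⟨hf, hb⟩ := M.f_homeo a h0
    obtain ⟨hg1, hg2⟩ := M.g_A0 a h0
    obtain ⟨p, -, q, -, -, -, hD⟩ := M.D_A0 a h0
    rw [continuousOn_iff_isClosed]
    intro t ht
    refine ⟨M.f a '' (M.D a ∩ t), ?_, ?_⟩
    · refine IsCompact.isClosed ?_
      refine IsCompact.image_of_continuousOn ?_ (hf.mono Set.inter_subset_left)
      rw [hD]
      exact isCompact_Icc.inter_right ht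
    · ext y
      constructor
      · rintro ⟨hy, hyR⟩
        exact ⟨⟨M.g a y, ⟨(hg2 y hyR).1, hy⟩, (hg2 y hyR).2⟩, hyR⟩
      · rintro ⟨⟨x, ⟨hx, hxt⟩, rfl⟩, hyR⟩
        refine ⟨?_, hyR⟩
        rw [Set.mem_preimage, hg1 x hx]
        exact hxt
  · obtain ⟨p, -, hp⟩ := M.D_A12 a (mem_A12_of_notMem_A0 h0)
    refine continuousOn_const.congr (f := fun _ => p) fun y hy => ?_
    have := M.mapsTo_g a hy
    rwa [hp] at this

lemma isClosed_Gr (a : M.A) : IsClosed (M.Gr a) := by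
  have : M.Gr a = {z : ℝ × ℝ | z ∈ (Set.univ ×ˢ M.R a) ∧
      (fun w : ℝ × ℝ => w.1 - M.g a w.2) z = 0} := by
    ext ⟨x, y⟩
    simp [mem_Gr_iff, sub_eq_zero]
  rw [this]
  have hc : ContinuousOn (fun w : ℝ × ℝ => w.1 - M.g a w.2) (Set.univ ×ˢ M.R a) :=
    continuousOn_fst.sub ((M.continuousOn_g a).comp continuousOn_snd fun z hz => hz.2)
  exact hc.preimage_isClosed_of_isClosed (isClosed_univ.prod (M.isClosed_R a)) isClosed_singleton

lemma R0_subset_R (a : M.A) : M.R0 a ⊆ M.R a := by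
  rcases M.A_cover a with h | h | h
  · rw [M.R0_A01 a (Or.inl h)]; exact interior_subset
  · rw [M.R0_A01 a (Or.inr h)]; exact interior_subset
  · rw [M.R0_A2 a h]

lemma D0_A0_eq {a : M.A} (ha : a ∈ M.A0) : ∃ p ∈ M.P, ∃ q ∈ M.P, p < q ∧
    (∀ r ∈ M.P, ¬(p < r ∧ r < q)) ∧ M.D a = Set.Icc p q ∧ M.D0 a = Set.Ioo p q := by
  obtain ⟨p, hp, q, hq, hpq, hr, hD⟩ := M.D_A0 a ha
  exact ⟨p, hp, q, hq, hpq, hr, hD, by rw [M.D0_A0 a ha, hD, interior_Icc]⟩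

lemma closure_D0 (a : M.A) : closure (M.D0 a) = M.D a := by
  by_cases h0 : a ∈ M.A0
  · obtain ⟨p, -, q, -, hpq, -, hD, hD0⟩ := M.D0_A0_eq h0
    rw [hD0, hD, closure_Ioo hpq.ne]
  · rw [M.D0_A12 a (mem_A12_of_notMem_A0 h0), (M.isClosed_D a).closure_eq]

lemma D_subset_R_of_D0_subset_R0 {a b : M.A} (h : M.D0 b ⊆ M.R0 a) : M.D b ⊆ M.R a := by
  rw [← closure_D0]
  exact closure_minimal (h.trans (M.R0_subset_R a)) (M.isClosed_R a)

lemma G0_subset_Gr (a : M.A) : M.G0 a ⊆ M.Gr a := by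
  rcases M.A_cover a with h | h | h
  · rw [M.G0_A0 a h, M.Gr_A0 a h, M.D0_A0 a h]
    exact fun z hz => ⟨interior_subset hz.1, hz.2⟩
  · rw [M.G0_A1 a h, M.Gr_A12 a (Or.inl h)]
    exact Set.prod_mono_right (M.R0_subset_R a)
  · rw [M.G0_A2 a h]

lemma mem_D0_of_mem_G0 {a : M.A} {x y : ℝ} (h : (x, y) ∈ M.G0 a) : x ∈ M.D0 a := by
  rcases M.A_cover a with ha | ha | ha
  · rw [M.G0_A0 a ha] at h; exact h.1
  · rw [M.G0_A1 a ha] at h; rw [M.D0_A12 a (Or.inl ha)]; exact h.1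
  · rw [M.D0_A12 a (Or.inr ha)]; exact mem_D_of_mem_Gr (M.G0_subset_Gr a h)

lemma mem_P_of_mem_D {a : M.A} (ha : a ∉ M.A0) {x : ℝ} (hx : x ∈ M.D a) : x ∈ M.P := by
  obtain ⟨p, hp, hD⟩ := M.D_A12 a (mem_A12_of_notMem_A0 ha)
  rw [hD] at hx
  exact hx ▸ hp

lemma notMem_P_of_mem_D0 {a : M.A} (ha : a ∈ M.A0) {x : ℝ} (hx : x ∈ M.D0 a) : x ∉ M.P := by
  obtain ⟨p, -, q, -, -, hr, -, hD⟩ := M.D0_A0_eq ha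
  rw [hD] at hx
  exact fun h => hr x h hx

lemma mem_R0_A1 {a : M.A} (ha : a ∈ M.A1) {y : ℝ} : y ∈ M.R0 a ↔ y ∈ M.R a ∧ y ∉ M.P := by
  obtain ⟨u, hu, v, hv, huv, hR, hP⟩ := M.R_A1 a ha
  rw [M.R0_A01 a (Or.inr ha), hR, interior_Icc]
  constructor
  · intro h
    refine ⟨Set.Ioo_subset_Icc_self h, fun hy => ?_⟩
    have : y ∈ Set.Icc u v ∩ (M.P : Set ℝ) := ⟨Set.Ioo_subset_Icc_self h, hy⟩
    rw [hP] at this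
    rcases this with rfl | rfl
    · exact lt_irrefl _ h.1
    · exact lt_irrefl _ h.2
  · rintro ⟨h, hy⟩
    exact ⟨lt_of_le_of_ne h.1 (by rintro rfl; exact hy hu),
      lt_of_le_of_ne h.2 (by rintro rfl; exact hy hv)⟩

lemma D_subset_Icc_of_mem {b : M.A} {x u v : ℝ} (hb : b ∈ M.A0) (hxb : x ∈ M.D b) (hx : x ∉ M.P)
    (hu : u ∈ M.P) (hv : v ∈ M.P) (hxu : x ∈ Set.Icc u v) : M.D b ⊆ Set.Icc u v := by
  obtain ⟨p, hp, q, hq, hpq, hr, hD⟩ := M.D_A0 b hb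
  rw [hD] at hxb ⊢
  have hux : u < x := lt_of_le_of_ne hxu.1 (by rintro rfl; exact hx hu)
  have hxv : x < v := lt_of_le_of_ne hxu.2 (by rintro rfl; exact hx hv)
  refine Set.Icc_subset_Icc ?_ ?_
  · by_contra! h
    exact hr u hu ⟨h, hux.trans_le hxb.2⟩
  · by_contra! h
    exact hr v hv ⟨hxb.1.trans_lt hxv, h⟩

lemma D_subset_R_of_mem {a b : M.A} {x : ℝ} (hx : x ∉ M.P) (hxb : x ∈ M.D b) (hxa : x ∈ M.R a) :
    M.D b ⊆ M.R a := by
  obtain ⟨u, hu, v, hv, -, hR⟩ := M.R_eq_Icc a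
  have hb : b ∈ M.A0 := by
    by_contra h
    exact hx (M.mem_P_of_mem_D h hxb)
  rw [hR] at hxa ⊢
  exact D_subset_Icc_of_mem hb hxb hx hu hv hxa

/-- The maps `f_a` send points of `P` to points of `P`. -/
lemma f_endpoint_mem_P {a : M.A} (ha : a ∈ M.A0) {x : ℝ} (hx : x ∈ M.D a) (hxP : x ∈ M.P) :
    M.f a x ∈ M.P := by
  obtain ⟨p, hp, q, hq, hpq, hr, hD⟩ := M.D_A0 a ha
  obtain ⟨u, hu, v, hv, huv, hR⟩ := M.R_A0 a ha
  obtain ⟨hf, hb⟩ := M.f_homeo a ha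
  rw [hD] at hf hb hx
  rw [hR] at hb
  have hx' : x = p ∨ x = q := by
    rcases eq_or_lt_of_le hx.1 with h | h
    · exact Or.inl h.symm
    · rcases eq_or_lt_of_le hx.2 with h' | h'
      · exact Or.inr h'
      · exact absurd ⟨h, h'⟩ (hr x hxP)
  have hp' : p ∈ Set.Icc p q := Set.left_mem_Icc.2 hpq.le
  have hq' : q ∈ Set.Icc p q := Set.right_mem_Icc.2 hpq.le
  obtain ⟨s, hs, hsu⟩ := hb.surjOn (Set.left_mem_Icc.2 huv.le)
  obtain ⟨t, ht, htv⟩ := hb.surjOn (Set.right_mem_Icc.2 huv.le)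
  rcases hf.strictMonoOn_of_injOn_Icc' hpq.le hb.injOn with h | h
  · have h1 : M.f a p = u :=
      le_antisymm (hsu ▸ h.monotoneOn hp' hs hs.1) (hb.mapsTo hp').1
    have h2 : M.f a q = v :=
      le_antisymm (hb.mapsTo hq').2 (htv ▸ h.monotoneOn ht hq' ht.2)
    rcases hx' with rfl | rfl
    · rwa [h1]
    · rwa [h2]
  · have h1 : M.f a p = v :=
      le_antisymm (hb.mapsTo hp').2 (htv ▸ h.antitoneOn hp' ht ht.1)
    have h2 : M.f a q = u :=
      le_antisymm (hsu ▸ h.antitoneOn hs hq' hs.2) (hb.mapsTo hq').1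
    rcases hx' with rfl | rfl
    · rwa [h1]
    · rwa [h2]

lemma mem_R0_of_mem_G0 {a : M.A} {x y : ℝ} (h : (x, y) ∈ M.G0 a) : y ∈ M.R0 a := by
  rcases M.A_cover a with ha | ha | ha
  · obtain ⟨p, hp, q, hq, hpq, hr, hD, hD0⟩ := M.D0_A0_eq ha
    obtain ⟨u, hu, v, hv, huv, hR⟩ := M.R_A0 a ha
    obtain ⟨hf, hb⟩ := M.f_homeo a ha
    rw [M.G0_A0 a ha, hD0] at h
    obtain ⟨hx, hy⟩ := h
    simp only at hx hy
    rw [M.R0_A01 a (Or.inl ha), hR, interior_Icc]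
    rw [hD] at hf hb
    rw [hR] at hb
    have hp' : p ∈ Set.Icc p q := Set.left_mem_Icc.2 hpq.le
    have hq' : q ∈ Set.Icc p q := Set.right_mem_Icc.2 hpq.le
    have hx' := Set.Ioo_subset_Icc_self hx
    rw [hy]
    rcases hf.strictMonoOn_of_injOn_Icc' hpq.le hb.injOn with h | h
    · exact ⟨(hb.mapsTo hp').1.trans_lt (h hp' hx' hx.1),
        (h hx' hq' hx.2).trans_le (hb.mapsTo hq').2⟩
    · exact ⟨(hb.mapsTo hq').1.trans_lt (h hx' hq' hx.2),
        (h hp' hx' hx.1).trans_le (hb.mapsTo hp').2⟩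
  · rw [M.G0_A1 a ha] at h; exact h.2
  · rw [M.G0_A2 a ha] at h; rw [M.R0_A2 a ha]; exact (mem_Gr_iff.1 h).1

lemma D0_subset_R0_of_mem {a b : M.A} {x : ℝ} (hxb : x ∈ M.D0 b) (hxa : x ∈ M.R0 a) :
    M.D0 b ⊆ M.R0 a := by
  by_cases hb : b ∈ M.A0
  · have hxP := notMem_P_of_mem_D0 hb hxb
    have hxD : x ∈ M.D b := by rw [← closure_D0]; exact subset_closure hxb
    have hsub := D_subset_R_of_mem hxP hxD (M.R0_subset_R a hxa)
    by_cases ha : a ∈ M.A2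
    · obtain ⟨u, hu, hR⟩ := M.R_A2 a ha
      rw [M.R0_A2 a ha, hR] at hxa
      exact absurd (hxa ▸ hu) hxP
    · have ha' : a ∈ M.A0 ∪ M.A1 := by
        rcases M.A_cover a with h | h | h
        exacts [Or.inl h, Or.inr h, absurd h ha]
      rw [M.R0_A01 a ha', M.D0_A0 b hb]
      exact interior_mono hsub
  · have hb' := mem_A12_of_notMem_A0 hb
    obtain ⟨p, -, hD⟩ := M.D_A12 b hb'
    rw [M.D0_A12 b hb', hD] at hxb ⊢
    rintro y rfl
    rwa [← hxb]

/-- The graphs `G₀(a)` with `a ∉ A₂` do not meet any other closed graph. -/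
lemma eq_of_mem_G0_of_mem_Gr (hpp : M.ProperlyParametrized) {a b : M.A} {x y : ℝ}
    (ha : a ∉ M.A2) (hxa : (x, y) ∈ M.G0 a) (hxb : (x, y) ∈ M.Gr b) : b = a := by
  by_contra hne
  have hdis : (x, y) ∉ M.G0 b := fun h => (Set.disjoint_left.1 (hpp.2 b a hne)) h hxa
  rcases M.A_cover b with hb | hb | hb
  · rw [M.Gr_A0 b hb] at hxb
    obtain ⟨hx, hy⟩ := hxb
    simp only at hx hy
    have hxD0 : x ∉ M.D0 b := fun h => hdis (by rw [M.G0_A0 b hb]; exact ⟨h, hy⟩)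
    have hxP : x ∈ M.P := by
      obtain ⟨p, hp, q, hq, hpq, hr, hD, hD0⟩ := M.D0_A0_eq hb
      rw [hD] at hx
      rw [hD0] at hxD0
      rcases eq_or_lt_of_le hx.1 with h | h
      · exact h ▸ hp
      · rcases eq_or_lt_of_le hx.2 with h' | h'
        · exact h' ▸ hq
        · exact absurd ⟨h, h'⟩ hxD0
    rcases M.A_cover a with h | h | h
    · exact notMem_P_of_mem_D0 h (mem_D0_of_mem_G0 hxa) hxP
    · exact ((mem_R0_A1 h).1 (mem_R0_of_mem_G0 hxa)).2 (hy ▸ f_endpoint_mem_P hb hx hxP)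
    · exact ha h
  · have hx := mem_D_of_mem_Gr hxb
    have hxP : x ∈ M.P := M.mem_P_of_mem_D (fun h => by
      have : b ∈ M.A0 ∩ M.A1 := ⟨h, hb⟩
      simp [M.A01] at this) hx
    rcases M.A_cover a with h | h | h
    · exact notMem_P_of_mem_D0 h (mem_D0_of_mem_G0 hxa) hxP
    · have hy := ((mem_R0_A1 h).1 (mem_R0_of_mem_G0 hxa)).2
      refine hdis ?_
      rw [M.G0_A1 b hb]
      exact ⟨hx, (mem_R0_A1 hb).2 ⟨(mem_Gr_iff.1 hxb).1, hy⟩⟩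
    · exact ha h
  · exact hdis (by rwa [M.G0_A2 b hb])

lemma eq_of_mem_G0 (hpp : M.ProperlyParametrized) {a b : M.A} {z : ℝ × ℝ}
    (ha : z ∈ M.G0 a) (hb : z ∈ M.G0 b) : a = b := by
  by_contra h
  exact Set.disjoint_left.1 (hpp.2 a b h) ha hb

lemma exists_label (hpp : M.ProperlyParametrized) {z : ℝ × ℝ} (hz : z ∈ M.GF) :
    ∃ a, z ∈ M.G0 a := by
  rw [← hpp.1] at hz
  exact Set.mem_iUnion.1 hz

/-- Every trajectory has a special label, which is a point of the associated shift. -/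
lemma exists_SFT_label (hpp : M.ProperlyParametrized) {x : ℕ → ℝ} (hx : x ∈ M.X) :
    ∃ u ∈ M.SFT, ∀ k, (x k, x (k + 1)) ∈ M.G0 (u k) := by
  choose u hu using fun k => exists_label hpp (hx.2 k)
  exact ⟨u, fun k => D0_subset_R0_of_mem (mem_D0_of_mem_G0 (hu (k + 1))) (mem_R0_of_mem_G0 (hu k)),
    hu⟩

/-! ### Essential words -/

lemma eq_of_finLabeled_of_eq {n : ℕ} {x y : Fin (n + 1) → ℝ} {u : Fin n → M.A}
    (hx : M.Labeled x u) (hy : M.Labeled y u) {k : Fin (n + 1)} (h : x k = y k) :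
    ∀ i ≤ k, x i = y i := by
  have key : ∀ i (hi : i ≤ (k : ℕ)), x ⟨i, by omega⟩ = y ⟨i, by omega⟩ := by
    intro i hi
    induction hi using Nat.decreasingInduction with
    | self => exact h
    | of_succ j hj ih =>
      have h1 := (mem_Gr_iff.1 (hx ⟨j, by omega⟩)).2
      have h2 := (mem_Gr_iff.1 (hy ⟨j, by omega⟩)).2
      simp only [Fin.castSucc_mk, Fin.succ_mk] at h1 h2
      rw [h1, h2, ih]
  exact fun i hi => key i hi

lemma SpecialLabeled.labeled {n : ℕ} {x : Fin (n + 1) → ℝ} {u : Fin n → M.A}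
    (h : M.SpecialLabeled x u) : M.Labeled x u :=
  fun i => M.G0_subset_Gr _ (h i)

lemma exists_specialLabeled (hpp : M.ProperlyParametrized) {n : ℕ} {x : Fin (n + 1) → ℝ}
    (hx : x ∈ M.finTraj (n + 1)) : ∃ u : Fin n → M.A, M.SpecialLabeled x u := by
  choose u hu using fun i : Fin n => exists_label hpp (hx.2 i.castSucc (by simp))
  exact ⟨u, hu⟩

lemma lang_step {n : ℕ} {u : Fin n → M.A} (hu : u ∈ M.Lang n) (i : ℕ) (h : i + 1 < n) :
    M.D0 (u ⟨i + 1, h⟩) ⊆ M.R0 (u ⟨i, by omega⟩) := by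
  obtain ⟨z, hz, m, hm⟩ := hu
  rw [hm, hm]
  exact hz (m + i)

lemma notMem_A0_of_D0_subset_R0_of_mem_A2 {a b : M.A} (ha : a ∈ M.A2)
    (h : M.D0 b ⊆ M.R0 a) : b ∉ M.A0 := by
  intro hb
  obtain ⟨p, hp, hR⟩ := M.R_A2 a ha
  obtain ⟨u, -, v, -, huv, -, -, hD0⟩ := M.D0_A0_eq hb
  obtain ⟨x, hx⟩ := Set.nonempty_Ioo.2 huv
  have hxP := notMem_P_of_mem_D0 hb (hD0 ▸ hx)
  rw [M.R0_A2 a ha, hR, hD0] at h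
  exact hxP (h hx ▸ hp)

lemma exists_later_A1 {n : ℕ} {u : Fin (n + 1) → M.A} (hu : u ∈ M.Lang (n + 1))
    (hlast : u (Fin.last n) ∉ M.A2) {i : Fin (n + 1)} (hi : u i ∈ M.A2) :
    ∃ k, i < k ∧ u k ∈ M.A1 := by
  by_contra! hcon
  have key : ∀ j (hj : j < n + 1), (i : ℕ) ≤ j → u ⟨j, hj⟩ ∈ M.A2 := by
    intro j
    induction j with
    | zero =>
      intro hj hij
      have : i = ⟨0, hj⟩ := Fin.ext (by simpa using hij)
      exact this ▸ hi
    | succ j ih =>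
      intro hj hij
      rcases Nat.lt_or_ge (i : ℕ) (j + 1) with h | h
      · have h2 := ih (by omega) (by omega)
        have h0 := notMem_A0_of_D0_subset_R0_of_mem_A2 h2 (lang_step hu j hj)
        rcases mem_A12_of_notMem_A0 h0 with h1 | h1
        · exact absurd h1 (hcon _ (by simpa [Fin.lt_def] using h))
        · exact h1
      · have : i = ⟨j + 1, hj⟩ := Fin.ext (le_antisymm hij h)
        exact this ▸ hi
  exact hlast (key n (by omega) (by omega))

lemma isClosed_setOf_labeled {n : ℕ} (v : Fin n → M.A) :
    IsClosed {x : M.finTraj (n + 1) | M.Labeled x.1 v} := by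
  have : {x : M.finTraj (n + 1) | M.Labeled x.1 v} =
      ⋂ i : Fin n, {x | (x.1 i.castSucc, x.1 i.succ) ∈ M.Gr (v i)} := by
    ext x; simp [Labeled]
  rw [this]
  refine isClosed_iInter fun i => (M.isClosed_Gr (v i)).preimage ?_
  exact ((continuous_apply _).comp continuous_subtype_val).prodMk
    ((continuous_apply _).comp continuous_subtype_val)

/-- A word of the language whose last letter is not in `A₂` is essential. -/
lemma essentialWord_of_last_notMem_A2 (hpp : M.ProperlyParametrized) {n : ℕ}
    {u : Fin (n + 1) → M.A} (hu : u ∈ M.Lang (n + 1)) (hlast : u (Fin.last n) ∉ M.A2) :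
    M.EssentialWord u := by
  have := M.finA
  refine ⟨hu, ?_⟩
  have huniq : ∀ (x : M.finTraj (n + 1 + 1)) (v : Fin (n + 1) → M.A), M.SpecialLabeled x.1 u →
      M.SpecialLabeled x.1 v → v = u := fun x v h1 h2 =>
    funext fun i => eq_of_mem_G0 hpp (h2 i) (h1 i)
  let S : (Fin (n + 1) → M.A) → Set (M.finTraj (n + 1 + 1)) := fun v => {x | M.SpecialLabeled x.1 v}
  have hcompl : (S u)ᶜ = ⋃ v : {v : Fin (n + 1) → M.A // v ≠ u}, S v := by
    ext x
    constructor
    · intro hx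
      obtain ⟨v, hv⟩ := exists_specialLabeled hpp x.2
      exact Set.mem_iUnion.2 ⟨⟨v, by rintro rfl; exact hx hv⟩, hv⟩
    · intro hx hxu
      obtain ⟨v, hv⟩ := Set.mem_iUnion.1 hx
      exact v.2 (huniq x v hxu hv)
  change IsOpen (S u)
  rw [← isClosed_compl_iff]
  refine isClosed_of_closure_subset ?_
  nth_rewrite 1 [hcompl]
  rw [closure_iUnion_of_finite]
  refine Set.iUnion_subset fun ⟨v, hv⟩ x hxv hxu => hv ?_
  have hxu' : M.SpecialLabeled x.1 u := hxu
  obtain ⟨y, hy⟩ : (S v).Nonempty := closure_nonempty_iff.1 ⟨x, hxv⟩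
  have hy' : M.SpecialLabeled y.1 v := hy
  have hlab : M.Labeled x.1 v :=
    closure_minimal (s := S v) (t := {x | M.Labeled x.1 v})
      (fun z hz => SpecialLabeled.labeled (x := z.1) hz) (isClosed_setOf_labeled v) hxv
  have h2 : ∀ i, u i ∉ M.A2 → v i = u i := fun i hi =>
    eq_of_mem_G0_of_mem_Gr hpp hi (hxu' i) (hlab i)
  have h1 : ∀ k, u k ∈ M.A1 → ∀ i < k, v i = u i := by
    intro k hk i hik
    obtain ⟨p, -, hD⟩ := M.D_A12 (v k) (by rw [h2 k (notMem_A2_of_mem_A1 hk)]; exact Or.inl hk)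
    have hp : ∀ z : M.finTraj (n + 1 + 1), M.Labeled z.1 v → z.1 k.castSucc = p := fun z hz => by
      have := mem_D_of_mem_Gr (hz k)
      rwa [hD] at this
    have heq := eq_of_finLabeled_of_eq hlab hy'.labeled ((hp x hlab).trans (hp y hy'.labeled).symm)
    have e1 := heq i.castSucc (Fin.castSucc_le_castSucc_iff.2 hik.le)
    have e2 := heq i.succ (Nat.succ_le_of_lt hik)
    have hyi := hy' i
    rw [← e1, ← e2] at hyi
    exact eq_of_mem_G0 hpp hyi (hxu' i)
  funext i
  by_cases hi : u i ∈ M.A2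
  · obtain ⟨k, hik, hk⟩ := exists_later_A1 hu hlast hi
    exact h1 k hk i hik
  · exact h2 i hi

lemma wordIn_of_mem {Z : Set (ℕ → M.A)} {u : ℕ → M.A} (hu : u ∈ Z) (n : ℕ) :
    M.WordIn (fun i : Fin n => u i) Z :=
  ⟨u, hu, 0, fun i => by simp⟩

lemma CC.exists_mem_X (hcc : M.CC) {y : ℝ} (hy : y ∈ Set.Icc (0 : ℝ) 1) :
    ∃ x ∈ M.X, x 0 = y := by
  obtain ⟨Z, -, -, h, -⟩ := hcc
  obtain ⟨-, -, x, hx, h0, -⟩ := h y hy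
  exact ⟨x, hx, h0⟩

/-- Finite trajectories extend to infinite ones. -/
lemma CC.exists_extension (hcc : M.CC) {n : ℕ} {y : Fin (n + 1) → ℝ}
    (hy : y ∈ M.finTraj (n + 1)) : ∃ x ∈ M.X, ∀ i : Fin (n + 1), x i = y i := by
  obtain ⟨s, hs, hs0⟩ := hcc.exists_mem_X (hy.1 (Fin.last n))
  refine ⟨fun k => if h : k < n + 1 then y ⟨k, h⟩ else s (k - n), ⟨fun k => ?_, fun k => ?_⟩,
    fun i => dif_pos i.2⟩
  · dsimp only
    split_ifs with h
    · exact hy.1 _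
    · exact hs.1 _
  · dsimp only
    by_cases h : k + 1 < n + 1
    · rw [dif_pos (by omega), dif_pos h]
      exact hy.2 ⟨k, by omega⟩ h
    · rw [dif_neg h]
      have hk : (if h : k < n + 1 then y ⟨k, h⟩ else s (k - n)) = s (k - n) := by
        split_ifs with h'
        · obtain rfl : k = n := by omega
          rw [Nat.sub_self, hs0]
          rfl
        · rfl
      rw [hk, Nat.sub_add_comm (by omega)]
      exact hs.2 _

lemma finTraj_of_mem_X {x : ℕ → ℝ} (hx : x ∈ M.X) (n : ℕ) :
    (fun i : Fin n => x i) ∈ M.finTraj n :=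
  ⟨fun i => hx.1 i, fun i _ => hx.2 i⟩

/-- If every trajectory close to `x` up to time `m` has an `A₂`-label at time `m`, then the word
labelling `x` up to that time is essential. -/
lemma essentialWord_of_forall_A2 (hpp : M.ProperlyParametrized) (hcc : M.CC) {x : ℕ → ℝ}
    (hx : x ∈ M.X) {u : ℕ → M.A} (hu : u ∈ M.SFT) (hxu : ∀ k, (x k, x (k + 1)) ∈ M.G0 (u k))
    {m : ℕ} {ε : ℝ} (hε : 0 < ε)
    (hall : ∀ y ∈ M.X, (∀ i ≤ m, |y i - x i| < ε) → ∀ a, (y m, y (m + 1)) ∈ M.G0 a → a ∈ M.A2) :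
    M.EssentialWord (fun i : Fin (m + 1) => u i) := by
  have := M.finA
  refine ⟨wordIn_of_mem hu _, ?_⟩
  let W : Set (M.finTraj (m + 1 + 1)) := {y | ∀ i : Fin (m + 1), |y.1 i.castSucc - x i| < ε}
  have hWo : IsOpen W := by
    have : W = ⋂ i : Fin (m + 1), {y | |y.1 i.castSucc - x i| < ε} := by ext; simp [W]
    rw [this]
    refine isOpen_iInter_of_finite fun i => isOpen_lt ?_ continuous_const
    exact (((continuous_apply _).comp continuous_subtype_val).sub continuous_const).abs
  have hA2 : ∀ y ∈ W, ∀ v : Fin (m + 1) → M.A, M.SpecialLabeled y.1 v →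
      v (Fin.last m) ∈ M.A2 := by
    intro y hy v hv
    obtain ⟨z, hz, hzy⟩ := hcc.exists_extension y.2
    refine hall z hz (fun i hi => ?_) _ ?_
    · have := hy ⟨i, by omega⟩
      rw [← hzy] at this
      exact this
    · have := hv (Fin.last m)
      rw [← hzy, ← hzy] at this
      simpa using this
  have hdet : ∀ y z : M.finTraj (m + 1 + 1), ∀ v : Fin (m + 1) → M.A, v (Fin.last m) ∈ M.A2 →
      M.SpecialLabeled y.1 v → M.SpecialLabeled z.1 v → y = z := by
    intro y z v hv hy hz
    obtain ⟨q, -, hq⟩ := M.R_A2 _ hv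
    have e1 := (mem_Gr_iff.1 (hy.labeled (Fin.last m))).1
    have e2 := (mem_Gr_iff.1 (hz.labeled (Fin.last m))).1
    rw [hq] at e1 e2
    have e3 : y.1 (Fin.last (m + 1)) = z.1 (Fin.last (m + 1)) := e1.trans e2.symm
    exact Subtype.ext (funext fun i =>
      eq_of_finLabeled_of_eq hy.labeled hz.labeled e3 i (Fin.le_last i))
  have hWf : W.Finite := by
    choose lab hlab using fun y : M.finTraj (m + 1 + 1) => exists_specialLabeled hpp y.2
    refine Set.Finite.of_finite_image (f := lab) (Set.toFinite _) fun y hy z hz hyz => ?_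
    exact hdet y z (lab y) (hA2 y hy _ (hlab y)) (hlab y) (hyz ▸ hlab z)
  let x' : M.finTraj (m + 1 + 1) := ⟨fun i => x i, finTraj_of_mem_X hx _⟩
  have hx'u : M.SpecialLabeled x'.1 (fun i : Fin (m + 1) => u i) := fun i => by
    simpa [x'] using hxu i
  have hx'W : x' ∈ W := fun i => by simpa [x'] using hε
  have hS : {y : M.finTraj (m + 1 + 1) | M.SpecialLabeled y.1 (fun i : Fin (m + 1) => u i)} =
      W \ (W \ {x'}) := by
    ext y
    constructor
    · intro hy
      obtain rfl : y = x' := hdet y x' _ (hA2 x' hx'W _ hx'u) hy hx'u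
      exact ⟨hx'W, fun h => h.2 rfl⟩
    · rintro ⟨h1, h2⟩
      have : y = x' := by by_contra h; exact h2 ⟨h1, h⟩
      rw [this]
      exact hx'u
  rw [hS]
  exact hWo.sdiff (hWf.subset Set.sdiff_subset).isClosed

/-! ### Pulling back trajectories along words -/

/-- Prepend to the sequence `s` its successive preimages under the inverse maps of the word. -/
noncomputable def pull (M : MarkovMultiMap) : List M.A → (ℕ → ℝ) → ℕ → ℝ
  | [], s => s
  | a :: l, s => fun k => Nat.casesOn k (M.g a (pull M l s 0)) (pull M l s)

/-- The domain of the first letter of a word, or `K` for the empty word. -/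
def dom (M : MarkovMultiMap) : List M.A → Set ℝ → Set ℝ
  | [], K => K
  | a :: _, _ => M.D a

/-- The word is a chain of symbols whose successive ranges cover the next domain, the last range
covering `K`. -/
def Admissible (M : MarkovMultiMap) : List M.A → Set ℝ → Prop
  | [], _ => True
  | a :: l, K => M.dom l K ⊆ M.R a ∧ Admissible M l K

/-- The first `n` symbols of a symbolic sequence. -/
def seg : (ℕ → M.A) → ℕ → List M.A
  | _, 0 => []
  | u, n + 1 => u 0 :: seg (fun k => u (k + 1)) n

lemma length_seg (u : ℕ → M.A) (n : ℕ) : (seg u n).length = n := by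
  induction n generalizing u with
  | zero => rfl
  | succ n ih => simp [seg, ih]

lemma seg_eq_ofFn (u : ℕ → M.A) (n : ℕ) : seg u n = List.ofFn (fun i : Fin n => u i) := by
  induction n generalizing u with
  | zero => rfl
  | succ n ih => simp [seg, ih, List.ofFn_succ]

lemma pull_append (l₁ l₂ : List M.A) (s : ℕ → ℝ) :
    M.pull (l₁ ++ l₂) s = M.pull l₁ (M.pull l₂ s) := by
  induction l₁ with
  | nil => rfl
  | cons a l ih => simp [pull, ih]

lemma pull_length_add (l : List M.A) (s : ℕ → ℝ) (k : ℕ) : M.pull l s (l.length + k) = s k := by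
  induction l with
  | nil => simp [pull]
  | cons a l ih =>
    rw [List.length_cons, Nat.add_right_comm]
    exact ih

lemma pull_zero (l : List M.A) (s : ℕ → ℝ) : M.pull l s 0 = gWordList M l (s 0) := by
  induction l with
  | nil => rfl
  | cons a l ih => simp [pull, gWordList, ih]

lemma pull_congr (l : List M.A) {s t : ℕ → ℝ} (h : s 0 = t 0) {i : ℕ} (hi : i ≤ l.length) :
    M.pull l s i = M.pull l t i := by
  induction l generalizing i with
  | nil =>
    obtain rfl : i = 0 := by simpa using hi
    exact h
  | cons a l ih =>
    cases i with
    | zero => simp [pull, ih (Nat.zero_le _)]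
    | succ i => exact ih (by simpa using hi)

lemma dom_append (l₁ l₂ : List M.A) (K : Set ℝ) :
    M.dom (l₁ ++ l₂) K = M.dom l₁ (M.dom l₂ K) := by
  cases l₁ <;> rfl

lemma Admissible.append {l₁ l₂ : List M.A} {K : Set ℝ} (h₁ : M.Admissible l₁ (M.dom l₂ K))
    (h₂ : M.Admissible l₂ K) : M.Admissible (l₁ ++ l₂) K := by
  induction l₁ with
  | nil => exact h₂
  | cons a l ih => exact ⟨(dom_append l l₂ K).trans_subset h₁.1, ih h₁.2⟩

lemma Admissible.pull_zero_mem {l : List M.A} {K : Set ℝ} (h : M.Admissible l K) {s : ℕ → ℝ}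
    (hs : s 0 ∈ K) : M.pull l s 0 ∈ M.dom l K := by
  induction l with
  | nil => exact hs
  | cons a l ih => exact M.mapsTo_g a (h.1 (ih h.2))

lemma Admissible.pull_mem_GF {l : List M.A} {K : Set ℝ} (h : M.Admissible l K) {s : ℕ → ℝ}
    (hs : s 0 ∈ K) {i : ℕ} (hi : i < l.length) : (M.pull l s i, M.pull l s (i + 1)) ∈ M.GF := by
  induction l generalizing i with
  | nil => simp at hi
  | cons a l ih =>
    cases i with
    | zero => exact mem_GF_of_mem_Gr (mem_Gr_iff.2 ⟨h.1 (h.2.pull_zero_mem hs), rfl⟩)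
    | succ i => exact ih h.2 (by simpa using hi)

lemma fst_mem_Icc_of_mem_GF {z : ℝ × ℝ} (h : z ∈ M.GF) : z.1 ∈ Set.Icc (0 : ℝ) 1 := by
  obtain ⟨a, ha⟩ := Set.mem_iUnion.1 h
  exact M.D_subset a (mem_D_of_mem_Gr (x := z.1) (y := z.2) ha)

lemma mem_X_of_forall_mem_GF {x : ℕ → ℝ} (h : ∀ k, (x k, x (k + 1)) ∈ M.GF) : x ∈ M.X :=
  ⟨fun k => fst_mem_Icc_of_mem_GF (h k), h⟩

lemma Admissible.pull_mem_X {l : List M.A} {K : Set ℝ} (h : M.Admissible l K) {s : ℕ → ℝ}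
    (hs : s 0 ∈ K) (hsX : s ∈ M.X) : M.pull l s ∈ M.X := by
  refine mem_X_of_forall_mem_GF fun k => ?_
  rcases Nat.lt_or_ge k l.length with hk | hk
  · exact h.pull_mem_GF hs hk
  · obtain ⟨j, rfl⟩ := Nat.exists_eq_add_of_le hk
    rw [Nat.add_assoc, pull_length_add, pull_length_add]
    exact hsX.2 j

lemma Admissible.continuousOn_pull {l : List M.A} {K : Set ℝ} (h : M.Admissible l K) (i : ℕ) :
    ContinuousOn (fun r => M.pull l (fun _ => r) i) K := by
  induction l generalizing i with
  | nil => exact continuousOn_id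
  | cons a l ih =>
    cases i with
    | zero =>
      exact (M.continuousOn_g a).comp (ih h.2 0) fun r hr =>
        h.1 (h.2.pull_zero_mem (s := fun _ => r) hr)
    | succ i => exact ih h.2 i

lemma admissible_seg_succ {u : ℕ → M.A} (hu : u ∈ M.SFT) {n : ℕ} {K : Set ℝ}
    (hK : K ⊆ M.R (u n)) : M.Admissible (seg u (n + 1)) K := by
  induction n generalizing u with
  | zero => exact ⟨hK, trivial⟩
  | succ n ih =>
    exact ⟨D_subset_R_of_D0_subset_R0 (hu 0), ih (u := fun k => u (k + 1)) (fun k => hu (k + 1)) hK⟩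

lemma admissible_seg {u : ℕ → M.A} (hu : u ∈ M.SFT) (n : ℕ) :
    M.Admissible (seg u n) (M.D (u n)) := by
  cases n with
  | zero => trivial
  | succ n => exact admissible_seg_succ hu (D_subset_R_of_D0_subset_R0 (hu n))

lemma dom_seg (u : ℕ → M.A) (n : ℕ) : M.dom (seg u n) (M.D (u n)) = M.D (u 0) := by
  cases n <;> rfl

lemma pull_seg {x : ℕ → ℝ} {u : ℕ → M.A} {n : ℕ} (h : ∀ k < n, (x k, x (k + 1)) ∈ M.Gr (u k))
    {s : ℕ → ℝ} (hs : s 0 = x n) {i : ℕ} (hi : i ≤ n) : M.pull (seg u n) s i = x i := by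
  induction n generalizing x u i with
  | zero =>
    obtain rfl : i = 0 := by omega
    exact hs
  | succ n ih =>
    have ih' := fun {i} => ih (x := fun k => x (k + 1)) (u := fun k => u (k + 1))
      (fun k hk => h (k + 1) (by omega)) hs (i := i)
    cases i with
    | zero =>
      refine Eq.trans ?_ (mem_Gr_iff.1 (h 0 (by omega))).2.symm
      exact congrArg (M.g (u 0)) (ih' (Nat.zero_le _))
    | succ i => exact ih' (by omega)

lemma shift_mem_SFT {u : ℕ → M.A} (hu : u ∈ M.SFT) (m : ℕ) : (fun k => u (m + k)) ∈ M.SFT :=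
  fun k => hu (m + k)

lemma WordFromTo.exists_admissible {C : Set M.A} {a b : M.A} {n : ℕ} (h : M.WordFromTo C a b n) :
    ∃ l : List M.A, l.length = n ∧ M.Admissible l (M.D b) ∧ M.dom l (M.D b) = M.D a := by
  obtain ⟨u, ⟨⟨z, hz, m, hm⟩, -⟩, rfl, rfl⟩ := h
  rw [hm, hm]
  exact ⟨seg (fun k => z (m + k)) n, length_seg _ _, admissible_seg (shift_mem_SFT hz m) n,
    dom_seg _ n⟩

lemma iterate_shift_apply (x : M.X) (n k : ℕ) : (M.shift^[n] x).1 k = x.1 (n + k) := by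
  induction n generalizing x with
  | zero => simp
  | succ n ih =>
    rw [Function.iterate_succ_apply, ih]
    exact congrArg x.1 (Nat.add_right_comm n k 1)

/-! ### Small neighbourhoods -/

lemma exists_cylinder_subset {U : Set M.X} (hU : IsOpen U) {x : M.X} (hx : x ∈ U) :
    ∃ m : ℕ, ∃ ε > 0, ∀ y : M.X, (∀ i ≤ m, |y.1 i - x.1 i| < ε) → y ∈ U := by
  obtain ⟨U', hU', rfl⟩ := isOpen_induced_iff.1 hU
  obtain ⟨I, u, hu, hsub⟩ := isOpen_pi_iff.1 hU' x.1 hx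
  have h : ∀ᶠ ε in 𝓝[>] (0 : ℝ), ∀ i ∈ I, Metric.ball (x.1 i) ε ⊆ u i := by
    rw [Filter.eventually_all_finset]
    intro i hi
    obtain ⟨e, he, hb⟩ := Metric.isOpen_iff.1 (hu i hi).1 _ (hu i hi).2
    filter_upwards [Ioo_mem_nhdsGT he] with ε hε
    exact (Metric.ball_subset_ball hε.2.le).trans hb
  obtain ⟨ε, hε, hε0⟩ := (h.and self_mem_nhdsWithin).exists
  refine ⟨I.sup id, ε, hε0, fun y hy => hsub fun i hi => hε i hi ?_⟩
  rw [Metric.mem_ball, Real.dist_eq]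
  exact hy i (Finset.le_sup (f := id) hi)

lemma exists_near_notMem_finset {p q x δ : ℝ} (hpq : p < q) (hx : x ∈ Set.Icc p q) (hδ : 0 < δ)
    (P : Finset ℝ) : ∃ y ∈ Set.Icc p q, |y - x| < δ ∧ y ∉ P := by
  have hlt : max p (x - δ) < min q (x + δ) := by
    refine max_lt (lt_min hpq ?_) (lt_min ?_ ?_) <;> linarith [hx.1, hx.2]
  obtain ⟨y, hy, hyP⟩ := (Set.Ioo_infinite hlt).exists_notMem_finset P
  obtain ⟨h1, h2⟩ := max_lt_iff.1 hy.1
  obtain ⟨h3, h4⟩ := lt_min_iff.1 hy.2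
  exact ⟨y, ⟨h1.le, h3.le⟩, abs_lt.2 ⟨by linarith, by linarith⟩, hyP⟩

lemma abs_sub_le_intervalLen {I : Set ℝ} (hI : Bornology.IsBounded I) {x y : ℝ} (hx : x ∈ I)
    (hy : y ∈ I) : |x - y| ≤ intervalLen I := by
  have h1 := le_csSup hI.bddAbove hx
  have h2 := le_csSup hI.bddAbove hy
  have h3 := csInf_le hI.bddBelow hx
  have h4 := csInf_le hI.bddBelow hy
  unfold intervalLen
  exact abs_sub_le_iff.2 ⟨by linarith, by linarith⟩

lemma isBounded_Iword {n : ℕ} {z : ℕ → M.A} (hz : z ∈ M.SFT) :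
    Bornology.IsBounded (M.Iword (fun i : Fin (n + 1) => z i)) := by
  refine (Metric.isBounded_Icc (0 : ℝ) 1).subset ?_
  rintro _ ⟨r, hr, rfl⟩
  rw [gWord, ← seg_eq_ofFn z (n + 1), ← pull_zero (s := fun _ => r)]
  exact M.D_subset (z 0) ((admissible_seg_succ (n := n) hz subset_rfl).pull_zero_mem hr)

/-- The Coding Condition provides, at a point `y ∉ P`, a loop in the symbol graph based at an
essential symbol `b`, along which all trajectories start close to `y`. -/
lemma CC.exists_loop (hpp : M.ProperlyParametrized) (hcc : M.CC) {y δ : ℝ}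
    (hy : y ∈ Set.Icc (0 : ℝ) 1) (hyP : y ∉ M.P) (hδ : 0 < δ) :
    ∃ b ∈ M.Ess, y ∈ M.D b ∧ ∃ l : List M.A, M.Admissible l (M.D b) ∧
      M.dom l (M.D b) = M.D b ∧ ∀ s : ℕ → ℝ, s 0 ∈ M.D b → |M.pull l s 0 - y| < δ := by
  obtain ⟨Z, ⟨hZ, -, -⟩, htr, hcode, hlen⟩ := hcc
  obtain ⟨z, hz, x, hx, rfl, hxz⟩ := hcode y hy
  obtain ⟨N, hN⟩ := hlen δ hδ
  have hyD := mem_D_of_mem_Gr (hxz 0)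
  have hz0 : z 0 ∈ M.A0 := by
    by_contra h
    exact hyP (mem_P_of_mem_D h hyD)
  obtain ⟨z', hz', m, n, hm, hn⟩ := htr (z (N + 1)) (z 0) ⟨z, hz, _, rfl⟩ ⟨z, hz, _, rfl⟩
  have h3 := admissible_seg (shift_mem_SFT (hZ hz') m) n
  have d3 := dom_seg (fun k => z' (m + k)) n
  simp only [hn, Nat.add_zero, hm] at h3 d3
  set l₃ := seg (fun k => z' (m + k)) n
  have h2 := admissible_seg (hZ hz) (N + 1)
  refine ⟨z 0, ⟨1, fun i : Fin 1 => z i, ?_, 0, rfl⟩, hyD, seg z (N + 1) ++ l₃,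
    Admissible.append (d3 ▸ h2) h3, ?_, fun s hs => ?_⟩
  · exact essentialWord_of_last_notMem_A2 hpp (wordIn_of_mem (hZ hz) 1)
      (notMem_A2_of_mem_A0 (by simpa using hz0))
  · rw [dom_append, d3, dom_seg]
  · refine (abs_sub_le_intervalLen (isBounded_Iword (n := N) (hZ hz)) ?_ ?_).trans_lt
      (hN N le_rfl _ (wordIn_of_mem hz _))
    · refine ⟨M.pull l₃ s 0, ?_, ?_⟩
      · have := h3.pull_zero_mem hs
        rw [d3] at this
        exact D_subset_R_of_D0_subset_R0 (hZ hz N) this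
      · rw [gWord, ← seg_eq_ofFn z (N + 1), pull_append, ← pull_zero]
    · refine ⟨x (N + 1), (mem_Gr_iff.1 (hxz N)).1, ?_⟩
      rw [gWord, ← seg_eq_ofFn z (N + 1), ← pull_zero (s := fun _ => x (N + 1))]
      exact pull_seg (n := N + 1) (fun k _ => hxz k) rfl (Nat.zero_le _)

/-- Every nonempty open set contains all trajectories following a suitable word, which starts at
an essential symbol and can be continued by an essential symbol. -/
lemma exists_word_forcing (hpp : M.ProperlyParametrized) (hcc : M.CC) {U : Set M.X}
    (hU : IsOpen U) (hne : U.Nonempty) :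
    ∃ l : List M.A, ∃ a ∈ M.Ess, ∃ b ∈ M.Ess, M.Admissible l (M.D b) ∧
      M.dom l (M.D b) = M.D a ∧ ∀ s : ℕ → ℝ, s 0 ∈ M.D b →
        ∀ x : M.X, (∀ i ≤ l.length, x.1 i = M.pull l s i) → x ∈ U := by
  obtain ⟨x, hxU⟩ := hne
  obtain ⟨m, ε, hε, hcyl⟩ := exists_cylinder_subset hU hxU
  by_cases hall : ∀ y ∈ M.X, (∀ i ≤ m, |y i - x.1 i| < ε) →
      ∀ a, (y m, y (m + 1)) ∈ M.G0 a → a ∈ M.A2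
  · obtain ⟨u, hu, hxu⟩ := exists_SFT_label hpp x.2
    have hess := essentialWord_of_forall_A2 hpp hcc x.2 hu hxu hε hall
    have hum : u m ∈ M.A2 := hall x.1 x.2 (fun i _ => by simpa using hε) _ (hxu m)
    refine ⟨seg u m, u 0, ⟨_, _, hess, 0, rfl⟩, u m, ⟨_, _, hess, Fin.last m, rfl⟩,
      admissible_seg hu m, dom_seg u m, fun s hs y hy => hcyl y fun i hi => ?_⟩
    obtain ⟨p, -, hp⟩ := M.D_A12 (u m) (Or.inr hum)
    have hxm := mem_D_of_mem_Gr (M.G0_subset_Gr _ (hxu m))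
    rw [hp] at hs hxm
    rw [hy i (by rwa [length_seg]),
      pull_seg (fun k _ => M.G0_subset_Gr _ (hxu k)) (hs.trans hxm.symm) hi]
    simpa using hε
  · push Not at hall
    obtain ⟨y, hyX, hyx, a, ha, haA2⟩ := hall
    obtain ⟨u, hu, hyu⟩ := exists_SFT_label hpp hyX
    obtain rfl := eq_of_mem_G0 hpp ha (hyu m)
    have hadm := admissible_seg_succ hu (n := m) subset_rfl
    have hyR := (mem_Gr_iff.1 (M.G0_subset_Gr _ ha)).1
    have hev : ∀ᶠ r in 𝓝[M.R (u m)] (y (m + 1)), ∀ i ∈ Finset.range (m + 1),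
        |M.pull (seg u (m + 1)) (fun _ => r) i - x.1 i| < ε := by
      rw [Filter.eventually_all_finset]
      intro i hi
      rw [Finset.mem_range] at hi
      have hc := (((hadm.continuousOn_pull i).sub continuousOn_const).abs :
        ContinuousOn (fun r => |M.pull (seg u (m + 1)) (fun _ => r) i - x.1 i|) _) _ hyR
      refine hc.eventually (gt_mem_nhds ?_)
      have hi' := pull_seg (n := m + 1) (s := fun _ => y (m + 1))
        (fun k _ => M.G0_subset_Gr _ (hyu k)) rfl hi.le
      change |M.pull (seg u (m + 1)) (fun _ => y (m + 1)) i - x.1 i| < ε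
      rw [hi']
      exact hyx i (by omega)
    obtain ⟨δ, hδ, hball⟩ := Metric.mem_nhdsWithin_iff.1 hev
    obtain ⟨p, hp, q, hq, hpq, hR⟩ := M.R_eq_Icc_of_notMem_A2 haA2
    obtain ⟨w, hwR, hwy, hwP⟩ := exists_near_notMem_finset hpq (hR ▸ hyR) (half_pos hδ) M.P
    rw [← hR] at hwR
    obtain ⟨b, hb, hwb, l, hl, dl, hlw⟩ :=
      hcc.exists_loop hpp (M.R_subset _ hwR) hwP (half_pos hδ)
    have hsub : M.D b ⊆ M.R (u m) := D_subset_R_of_mem hwP hwb hwR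
    have hess := essentialWord_of_last_notMem_A2 hpp (wordIn_of_mem hu (m + 1)) haA2
    refine ⟨seg u (m + 1) ++ l, u 0, ⟨_, _, hess, 0, rfl⟩, b, hb,
      (dl.symm ▸ admissible_seg_succ hu hsub).append hl, by rw [dom_append]; rfl,
      fun s hs z hz => hcyl z fun i hi => ?_⟩
    have hi' : i ≤ (seg u (m + 1)).length := by rw [length_seg]; omega
    rw [hz i (by rw [List.length_append]; omega), pull_append,
      pull_congr (t := fun _ => M.pull l s 0) _ rfl hi']
    refine hball ⟨?_, ?_⟩ i (Finset.mem_range.2 (by omega))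
    · rw [Metric.mem_ball, Real.dist_eq]
      have := abs_sub_le (M.pull l s 0) w (y (m + 1))
      linarith [hlw s hs]
    · have := hl.pull_zero_mem hs
      rw [dl] at this
      exact hsub this

/-! ### Mixing and density of periodic points -/

lemma topMixing_shift (hpp : M.ProperlyParametrized) (hcc : M.CC) {C : Set M.A}
    (hC : M.MixingSet C) (hEss : M.Ess ⊆ C) : TopMixing M.shift := by
  obtain ⟨N, -, hN⟩ := hC
  intro U V hU hV hUne hVne
  obtain ⟨l, a, -, b, hb, hl, -, hforce⟩ := exists_word_forcing hpp hcc hU hUne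
  obtain ⟨l', a', ha', b', -, hl', dl', hforce'⟩ := exists_word_forcing hpp hcc hV hVne
  refine ⟨l.length + N, fun n hn => ?_⟩
  obtain ⟨j, rfl⟩ := Nat.exists_eq_add_of_le ((Nat.le_add_right _ _).trans hn)
  obtain ⟨c, hclen, hc, dc⟩ :=
    (hN b (hEss hb) a' (hEss ha') j (by omega)).exists_admissible
  obtain ⟨r, hr⟩ := M.D_nonempty b'
  obtain ⟨s, hsX, rfl⟩ := hcc.exists_mem_X (M.D_subset _ hr)
  have hv0 := hl'.pull_zero_mem hr
  rw [dl'] at hv0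
  have hw0 := hc.pull_zero_mem hv0
  rw [dc] at hw0
  let v : M.X := ⟨M.pull l' s, hl'.pull_mem_X hr hsX⟩
  let x : M.X := ⟨M.pull l (M.pull c v.1), hl.pull_mem_X hw0 (hc.pull_mem_X hv0 v.2)⟩
  refine ⟨v, ⟨x, hforce _ hw0 x fun i _ => rfl, Subtype.ext (funext fun k => ?_)⟩,
    hforce' s hr v fun i _ => rfl⟩
  rw [iterate_shift_apply, Nat.add_assoc]
  change M.pull l _ _ = _
  rw [pull_length_add, ← hclen, pull_length_add]

/-- An admissible loop supports a periodic trajectory. -/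
lemma exists_periodic_of_loop {l : List M.A} {a : M.A} (hl : M.Admissible l (M.D a))
    (dl : M.dom l (M.D a) = M.D a) (hpos : 0 < l.length) :
    ∃ r ∈ M.D a, ∃ x : M.X, M.shift^[l.length] x = x ∧
      ∀ i < l.length, x.1 i = M.pull l (fun _ => r) i := by
  obtain ⟨p, -, q, -, hpq, -, hD⟩ := M.D_eq_Icc a
  have hmaps : MapsTo (fun r => M.pull l (fun _ => r) 0) (M.D a) (M.D a) := fun r hr => by
    have := hl.pull_zero_mem (s := fun _ => r) hr
    rwa [dl] at this
  have hcont := hl.continuousOn_pull 0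
  obtain ⟨r, hr, hfix⟩ := exists_mem_Icc_isFixedPt_of_mapsTo (hD ▸ hcont) hpq (by rwa [← hD])
  have h0 : M.pull l (fun _ => r) 0 = r := hfix
  have hlast : M.pull l (fun _ => r) l.length = r := pull_length_add l (fun _ => r) 0
  rw [← hD] at hr
  refine ⟨r, hr, ⟨fun k => M.pull l (fun _ => r) (k % l.length),
    mem_X_of_forall_mem_GF fun k => ?_⟩, Subtype.ext (funext fun k => ?_), fun i hi => ?_⟩
  · have hk := Nat.mod_lt k hpos
    have hstep : M.pull l (fun _ => r) ((k + 1) % l.length) =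
        M.pull l (fun _ => r) (k % l.length + 1) := by
      rcases Nat.lt_or_ge (k % l.length + 1) l.length with h | h
      · rw [← Nat.mod_add_mod, Nat.mod_eq_of_lt h]
      · have h' : k % l.length + 1 = l.length := by omega
        rw [← Nat.mod_add_mod, h', Nat.mod_self, h0, hlast]
    rw [hstep]
    exact hl.pull_mem_GF (s := fun _ => r) hr hk
  · rw [iterate_shift_apply]
    simp
  · simp [Nat.mod_eq_of_lt hi]

lemma densePeriodic_shift (hpp : M.ProperlyParametrized) (hcc : M.CC) {C : Set M.A}
    (hC : M.MixingSet C) (hEss : M.Ess ⊆ C) : DensePeriodic M.shift := by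
  obtain ⟨N, hN1, hN⟩ := hC
  refine dense_iff_inter_open.2 fun U hU hUne => ?_
  obtain ⟨l, a, ha, b, hb, hl, dl, hforce⟩ := exists_word_forcing hpp hcc hU hUne
  obtain ⟨c, hclen, hc, dc⟩ := (hN b (hEss hb) a (hEss ha) N (by omega)).exists_admissible
  have hlen : (l ++ c).length = l.length + N := by rw [List.length_append, hclen]
  obtain ⟨r, hr, x, hx, hxr⟩ := exists_periodic_of_loop (l := l ++ c) (a := a)
    (Admissible.append (dc.symm ▸ hl) hc) (by rw [dom_append, dc, dl]) (by omega)
  have hw0 := hc.pull_zero_mem (s := fun _ => r) hr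
  rw [dc] at hw0
  refine ⟨x, hforce _ hw0 x fun i hi => ?_, (l ++ c).length, by omega, hx⟩
  rw [hxr i (by omega), pull_append]

end MarkovMultiMap

/-- If `Σ_M` satisfies the Coding Condition (CC) and the Mixing Condition (MC),
then the forward trajectory system `(X,T)` is topologically mixing and its periodic
points are dense in `X`. -/
theorem stmt3 (M : MarkovMultiMap) (hpp : M.ProperlyParametrized)
    (hcc : M.CC) (hmc : M.MC) :
    TopMixing M.shift ∧ DensePeriodic M.shift := by
  obtain ⟨C, ⟨hC, -⟩, hEss⟩ := hmc
  exact ⟨MarkovMultiMap.topMixing_shift hpp hcc hC hEss,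
    MarkovMultiMap.densePeriodic_shift hpp hcc hC hEss⟩
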